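/- Let r ≥ 2 and m ≥ 1 be integers, let G be an n-vertex graph with minimum degree δ(G) ≥ n/2 + 6r²m, let χ : E(G) → [r] be an edge-coloring, and fix a color k ∈ [r]. Suppose B₁, …, B_{2m} are pairwise vertex-disjoint bowtie subgraphs of G, each satisfying f(B_i, k) > 0. Then there exist Hamilton cycles H₁ and H₂ of G such that |χ⁻¹(k) ∩ E(H₁)| − |χ⁻¹(k) ∩ E(H₂)| ≥ 2m; in particular, either |χ⁻¹(k) ∩ E(H₁)| ≥ n/r + m or |χ⁻¹(k) ∩ E(H₂)| ≤ n/r − m, so some Hamilton cycle H of G has d_χ(H) ≥ m. -/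

import Mathlib

open SimpleGraph

/-- A bowtie on vertices `v₁,…,v₅`: five distinct vertices with edges
`v₁v₂, v₁v₃, v₁v₄, v₁v₅, v₂v₃, v₄v₅`. -/
def IsBowtie {V : Type*} (G : SimpleGraph V) (v₁ v₂ v₃ v₄ v₅ : V) : Prop :=
  [v₁, v₂, v₃, v₄, v₅].Nodup ∧
    G.Adj v₁ v₂ ∧ G.Adj v₁ v₃ ∧ G.Adj v₁ v₄ ∧ G.Adj v₁ v₅ ∧ G.Adj v₂ v₃ ∧ G.Adj v₄ v₅

/-- The color-counting function
`f(B,k) = 1_k(v₁v₂)+1_k(v₁v₃)+1_k(v₄v₅)−1_k(v₁v₄)−1_k(v₁v₅)−1_k(v₂v₃)` of a bowtie. -/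
def bowtieF {V : Type*} {r : ℕ} (χ : Sym2 V → Fin r) (v₁ v₂ v₃ v₄ v₅ : V) (k : Fin r) : ℤ :=
  (if χ s(v₁, v₂) = k then 1 else 0) + (if χ s(v₁, v₃) = k then 1 else 0)
    + (if χ s(v₄, v₅) = k then 1 else 0) - (if χ s(v₁, v₄) = k then 1 else 0)
    - (if χ s(v₁, v₅) = k then 1 else 0) - (if χ s(v₂, v₃) = k then 1 else 0)

/-- The multiset of edges of the path visiting the vertices of a list in order. -/
def pathEdges {V : Type*} : List V → Multiset (Sym2 V)
  | [] => 0
  | [_] => 0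
  | x :: y :: t => s(x, y) ::ₘ pathEdges (y :: t)

/-- The multiset of edges of the closed walk visiting the vertices of a list in cyclic order. -/
def cycleEdges {V : Type*} : List V → Multiset (Sym2 V)
  | [] => 0
  | x :: t => pathEdges (x :: (t ++ [x]))

section ListEdges

variable {V : Type*}

@[simp] lemma pathEdges_singleton (x : V) : pathEdges [x] = 0 := rfl

@[simp] lemma pathEdges_cons_cons (x y : V) (t : List V) :
    pathEdges (x :: y :: t) = s(x, y) ::ₘ pathEdges (y :: t) := rfl

lemma pathEdges_append_cons (A B : List V) (x : V) :
    pathEdges (A ++ x :: B) = pathEdges (A ++ [x]) + pathEdges (x :: B) := by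
  induction A with
  | nil => simp
  | cons a A ih => cases A with
    | nil => simp
    | cons b A => simpa using ih

lemma pathEdges_reverse (l : List V) : pathEdges l.reverse = pathEdges l := by
  induction l with
  | nil => rfl
  | cons a l ih => cases l with
    | nil => rfl
    | cons b l =>
      have h := pathEdges_append_cons l.reverse [a] b
      simp only [List.reverse_cons, List.append_assoc, List.cons_append, List.nil_append] at ih ⊢
      rw [h, ih, pathEdges_cons_cons, pathEdges_cons_cons, pathEdges_singleton,
        Sym2.eq_swap, Multiset.add_cons, add_zero]

lemma cycleEdges_append_comm (A B : List V) : cycleEdges (A ++ B) = cycleEdges (B ++ A) := by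
  cases A with
  | nil => simp
  | cons a A => cases B with
    | nil => simp
    | cons b B =>
      have h₁ := pathEdges_append_cons (a :: A) (B ++ [a]) b
      have h₂ := pathEdges_append_cons (b :: B) (A ++ [b]) a
      simp only [cycleEdges, List.cons_append, List.append_assoc] at h₁ h₂ ⊢
      rw [h₁, h₂, add_comm]

lemma cycleEdges_cons_append_singleton (x y : V) (t : List V) :
    cycleEdges (x :: (t ++ [y])) = s(x, y) ::ₘ pathEdges (x :: (t ++ [y])) := by
  have h := pathEdges_append_cons (x :: t) [x] y
  simp only [cycleEdges, List.append_assoc, List.cons_append, List.nil_append] at h ⊢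
  rw [h, pathEdges_cons_cons, pathEdges_singleton, Sym2.eq_swap, Multiset.add_cons, add_zero]

lemma pathEdges_le_append_left (A B : List V) : pathEdges A ≤ pathEdges (A ++ B) := by
  induction A with
  | nil => simp [pathEdges]
  | cons a A ih => cases A with
    | nil => simp
    | cons b A => simpa using ih

lemma pathEdges_le_append_right (A B : List V) : pathEdges B ≤ pathEdges (A ++ B) := by
  cases B with
  | nil => simp [pathEdges]
  | cons b B => rw [pathEdges_append_cons]; exact Multiset.le_add_left _ _

lemma pathEdges_le_of_infix {A B : List V} (h : A <:+: B) : pathEdges A ≤ pathEdges B := by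
  obtain ⟨s, t, rfl⟩ := h
  exact (pathEdges_le_append_right s A).trans (pathEdges_le_append_left _ t)

lemma pathEdges_le_cycleEdges (l : List V) : pathEdges l ≤ cycleEdges l := by
  cases l with
  | nil => rfl
  | cons x t => exact pathEdges_le_append_left (x :: t) [x]

lemma exists_of_mem_pathEdges {l : List V} {e : Sym2 V} (h : e ∈ pathEdges l) :
    ∃ A p q B, l = A ++ p :: q :: B ∧ e = s(p, q) := by
  induction l with
  | nil => simp [pathEdges] at h
  | cons a l ih => cases l with
    | nil => simp at h
    | cons b l =>
      rw [pathEdges_cons_cons, Multiset.mem_cons] at h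
      rcases h with rfl | h
      · exact ⟨[], a, b, l, rfl, rfl⟩
      · obtain ⟨A, p, q, B, hl, he⟩ := ih h
        exact ⟨a :: A, p, q, B, by rw [hl]; rfl, he⟩

/-- A closed walk can be rotated so that a given edge becomes the closing one. -/
lemma exists_rotation_of_mem_cycleEdges {l : List V} {e : Sym2 V} (h : e ∈ cycleEdges l)
    (hl : 2 ≤ l.length) :
    ∃ x t y, (x :: (t ++ [y])).Perm l ∧ cycleEdges (x :: (t ++ [y])) = cycleEdges l ∧
      e = s(x, y) := by
  cases l with
  | nil => simp at hl
  | cons z t =>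
    obtain ⟨A, p, q, B, hB, rfl⟩ := exists_of_mem_pathEdges h
    rcases List.eq_nil_or_concat B with rfl | ⟨B, w, rfl⟩
    · have h₁ : (z :: t) ++ [z] = (A ++ [p]) ++ [q] := by simpa using hB
      obtain ⟨h₂, h₃⟩ := List.append_inj' h₁ rfl
      obtain rfl : z = q := by simpa using h₃
      cases A with
      | nil =>
        have : t = [] := by simp_all
        simp [this] at hl
      | cons a A =>
        obtain ⟨rfl, rfl⟩ : z = a ∧ t = A ++ [p] := by simpa using h₂
        exact ⟨z, A, p, List.Perm.refl _, rfl, Sym2.eq_swap⟩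
    · have h₁ : (z :: t) ++ [z] = (A ++ p :: q :: B) ++ [w] := by simpa using hB
      obtain ⟨h₂, -⟩ := List.append_inj' h₁ rfl
      have h₃ : z :: t = (A ++ [p]) ++ (q :: B) := by simpa using h₂
      refine ⟨q, B ++ A, p, ?_, ?_, Sym2.eq_swap⟩
      · rw [h₃]
        simpa using (List.perm_append_comm (l₁ := q :: B) (l₂ := A ++ [p]))
      · rw [h₃, cycleEdges_append_comm]
        simp

/-- The effect of a rotation on the edges of a closed walk. -/
lemma cycleEdges_rotation (x y p q : V) (A B : List V) :
    s(x, y) ::ₘ s(p, q) ::ₘ cycleEdges (p :: ((A.reverse ++ x :: q :: B) ++ [y])) =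
      s(x, q) ::ₘ s(y, p) ::ₘ cycleEdges (x :: ((A ++ p :: q :: B) ++ [y])) := by
  rw [cycleEdges_cons_append_singleton, cycleEdges_cons_append_singleton]
  have h₁ := pathEdges_append_cons (p :: A.reverse) (q :: B ++ [y]) x
  have h₂ := pathEdges_append_cons (x :: A) (q :: B ++ [y]) p
  have h₃ := pathEdges_reverse (x :: A ++ [p])
  simp only [List.cons_append, List.append_assoc, List.reverse_append, List.reverse_cons,
    List.reverse_nil, List.nil_append, pathEdges_cons_cons] at h₁ h₂ h₃ ⊢
  rw [h₁, h₂, h₃]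
  simp only [← Multiset.singleton_add]
  rw [Sym2.eq_swap (a := p) (b := y)]
  abel

/-- A vertex can be inserted into an edge of a closed walk. -/
lemma exists_insert_cycleEdges {l : List V} {u w : V} (v : V) (h : s(u, w) ∈ cycleEdges l)
    (hl : 2 ≤ l.length) :
    ∃ l', l'.Perm (v :: l) ∧
      s(u, w) ::ₘ cycleEdges l' = s(v, u) ::ₘ s(v, w) ::ₘ cycleEdges l := by
  obtain ⟨x, t, y, hp, hc, he⟩ := exists_rotation_of_mem_cycleEdges h hl
  refine ⟨v :: x :: (t ++ [y]), hp.cons v, ?_⟩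
  have key : s(x, y) ::ₘ cycleEdges (v :: x :: (t ++ [y])) =
      s(v, x) ::ₘ s(v, y) ::ₘ cycleEdges (x :: (t ++ [y])) := by
    have := cycleEdges_cons_append_singleton v y (x :: t)
    rw [List.cons_append] at this
    rw [this, cycleEdges_cons_append_singleton, pathEdges_cons_cons]
    simp only [← Multiset.singleton_add]
    abel
  rw [← hc, he, key]
  rcases Sym2.eq_iff.1 he with ⟨rfl, rfl⟩ | ⟨rfl, rfl⟩
  · rfl
  · rw [Multiset.cons_swap]

/-- Pairwise distinct edges of a closed walk can be subdivided simultaneously. -/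
lemma exists_insert_finset_cycleEdges {ι : Type*} {l : List V} (u w v : ι → V)
    (hinj : Function.Injective fun i => s(u i, w i)) (hmem : ∀ i, s(u i, w i) ∈ cycleEdges l)
    (hl : 2 ≤ l.length) (S : Finset ι) :
    ∃ l' : List V, (l' : Multiset V) = l + ∑ i ∈ S, {v i} ∧
      cycleEdges l' + ∑ i ∈ S, {s(u i, w i)} =
        cycleEdges l + ∑ i ∈ S, ({s(v i, u i)} + {s(v i, w i)}) := by
  classical
  induction S using Finset.induction_on with
  | empty => exact ⟨l, by simp, by simp⟩
  | insert j S hj ih =>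
    obtain ⟨l₁, hp, hc⟩ := ih
    have hlen : 2 ≤ l₁.length := by
      rw [← Multiset.coe_card, hp, Multiset.card_add, Multiset.coe_card]
      omega
    have hm : s(u j, w j) ∈ cycleEdges l₁ := by
      have h₁ : s(u j, w j) ∈ cycleEdges l₁ + ∑ i ∈ S, {s(u i, w i)} := by
        rw [hc]
        exact Multiset.mem_add.2 (Or.inl (hmem j))
      refine (Multiset.mem_add.1 h₁).resolve_right fun h₂ => ?_
      obtain ⟨i, hi, hij⟩ := Multiset.mem_sum.1 h₂
      exact hj (hinj (Multiset.mem_singleton.1 hij) ▸ hi)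
    obtain ⟨l₂, hp₂, hc₂⟩ := exists_insert_cycleEdges (v j) hm hlen
    refine ⟨l₂, ?_, ?_⟩
    · rw [Finset.sum_insert hj, Multiset.coe_eq_coe.2 hp₂, ← Multiset.cons_coe, hp,
        ← Multiset.singleton_add]
      abel
    · rw [Finset.sum_insert hj, Finset.sum_insert hj]
      simp only [← Multiset.singleton_add] at hc₂
      calc cycleEdges l₂ + ({s(u j, w j)} + ∑ i ∈ S, {s(u i, w i)})
          = ({s(u j, w j)} + cycleEdges l₂) + ∑ i ∈ S, {s(u i, w i)} := by abel
        _ = {s(v j, u j)} + {s(v j, w j)} + (cycleEdges l₁ + ∑ i ∈ S, {s(u i, w i)}) := by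
          rw [hc₂]; abel
        _ = _ := by rw [hc]; abel

/-- If sufficiently many entries satisfy `Q` or `R`, some consecutive pair satisfies `R`, `Q`. -/
lemma exists_consecutive_of_length_le_countP (Q R : V → Prop) [DecidablePred Q] [DecidablePred R]
    (l : List V) (hne : l ≠ [])
    (h : l.length ≤ l.tail.countP (fun v => Q v) + l.dropLast.countP (fun v => R v)) :
    ∃ A p q B, l = A ++ p :: q :: B ∧ R p ∧ Q q := by
  induction l with
  | nil => exact absurd rfl hne
  | cons a l ih => cases l with
    | nil => simp at h
    | cons b l =>
      by_cases hab : R a ∧ Q b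
      · exact ⟨[], a, b, l, rfl, hab⟩
      · obtain ⟨A, p, q, B, hl, hpq⟩ := ih (by simp) (by
          simp only [List.tail_cons, List.dropLast_cons_cons, List.countP_cons,
            List.length_cons, decide_eq_true_eq] at h ⊢
          split_ifs at h <;> first | omega | tauto)
        exact ⟨a :: A, p, q, B, by rw [hl]; rfl, hpq⟩

end ListEdges

namespace SimpleGraph

variable {V : Type*} (G : SimpleGraph V)

/-- A closed walk through the vertices of a list containing prescribed edges of `G` can be
rearranged to use only edges of `G`, provided all degrees within the list are large. -/
lemma exists_perm_cycleEdges_subset_edgeSet [DecidableEq V] [DecidableRel G.Adj]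
    (X : Finset V) (M : Set (Sym2 V)) (hMG : M ⊆ G.edgeSet) (hMX : ∀ e ∈ M, ∀ v ∈ e, v ∈ X)
    (l : List V) (hl : 2 ≤ l.length) (hnd : l.Nodup) (hM : ∀ e ∈ M, e ∈ cycleEdges l)
    (hdeg : ∀ x, l.length + X.card ≤ 2 * l.countP (fun v => G.Adj x v)) :
    ∃ l' : List V, l'.Perm l ∧ (∀ e ∈ M, e ∈ cycleEdges l') ∧
      ∀ e ∈ cycleEdges l', e ∈ G.edgeSet := by
  induction hn : (cycleEdges l).countP (fun e => e ∉ G.edgeSet) using Nat.strong_induction_on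
    generalizing l with
  | _ n ih =>
    by_cases hall : ∀ e ∈ cycleEdges l, e ∈ G.edgeSet
    · exact ⟨l, List.Perm.refl _, hM, hall⟩
    push Not at hall
    obtain ⟨e, he, heG⟩ := hall
    obtain ⟨x, t, y, hp, hc, rfl⟩ := exists_rotation_of_mem_cycleEdges he hl
    have hxy : ¬ G.Adj x y := heG
    have hyx : ¬ G.Adj y x := fun h => hxy h.symm
    have hX : (x :: (t ++ [y])).countP (fun v => v ∈ X) ≤ X.card := by
      rw [List.countP_eq_length_filter,
        ← List.toFinset_card_of_nodup ((hp.nodup_iff.2 hnd).filter _)]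
      refine Finset.card_le_card fun v hv => ?_
      simp only [List.mem_toFinset, List.mem_filter, decide_eq_true_eq] at hv
      exact hv.2
    have hsub : ∀ L : List V, L.countP (fun v => G.Adj y v) ≤
        L.countP (fun v => G.Adj y v ∧ v ∉ X) + L.countP (fun v => v ∈ X) := by
      intro L
      induction L with
      | nil => simp
      | cons a L ihL =>
        simp only [List.countP_cons, decide_eq_true_eq]
        split_ifs <;> first | omega | tauto
    have hdx := hdeg x
    have hdy := hdeg y
    rw [← hp.countP_eq, ← hp.length_eq] at hdx hdy
    have hsy := hsub (x :: (t ++ [y]))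
    have htail : (x :: (t ++ [y])).tail.countP (fun v => G.Adj x v) =
        (x :: (t ++ [y])).countP (fun v => G.Adj x v) := by simp
    have hdrop : (x :: (t ++ [y])).dropLast.countP (fun v => G.Adj y v ∧ v ∉ X) =
        (x :: (t ++ [y])).countP (fun v => G.Adj y v ∧ v ∉ X) := by
      rw [← List.cons_append, List.dropLast_concat, List.countP_append]
      simp [hyx]
    obtain ⟨A, p, q, B, hsplit, ⟨hyp, hpX⟩, hxq⟩ := exists_consecutive_of_length_le_countP
      (fun v => G.Adj x v) (fun v => G.Adj y v ∧ v ∉ X) (x :: (t ++ [y])) (by simp) (by omega)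
    obtain ⟨A, rfl⟩ : ∃ A', A = x :: A' := by
      cases A with
      | nil =>
        obtain rfl : x = p := by simpa using (List.cons.inj hsplit).1
        exact absurd hyp hyx
      | cons a A => exact ⟨A, by rw [(List.cons.inj hsplit).1]⟩
    obtain ⟨B, rfl⟩ : ∃ B', B = B' ++ [y] := by
      rcases List.eq_nil_or_concat B with rfl | ⟨B, w, rfl⟩
      · have h₁ : (x :: t) ++ [y] = (x :: A ++ [p]) ++ [q] := by simpa using hsplit
        obtain rfl : y = q := by simpa using (List.append_inj' h₁ rfl).2
        exact absurd hxq hxy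
      · have h₁ : (x :: t) ++ [y] = (x :: A ++ p :: q :: B) ++ [w] := by simpa using hsplit
        obtain rfl : y = w := by simpa using (List.append_inj' h₁ rfl).2
        exact ⟨B, by simp⟩
    have hsplit' : x :: (t ++ [y]) = x :: ((A ++ p :: q :: B) ++ [y]) := by simpa using hsplit
    have hrot := cycleEdges_rotation x y p q A B
    rw [← hsplit', hc] at hrot
    set l' := p :: ((A.reverse ++ x :: q :: B) ++ [y]) with hl'
    have hperm : l'.Perm l := by
      refine List.Perm.trans ?_ hp
      rw [hsplit', hl', ← Multiset.coe_eq_coe]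
      simp only [← Multiset.cons_coe, ← Multiset.coe_add, Multiset.coe_reverse,
        ← Multiset.singleton_add]
      abel
    have hlt : (cycleEdges l').countP (fun e => e ∉ G.edgeSet) < n := by
      have := congrArg (Multiset.countP (fun e => e ∉ G.edgeSet)) hrot
      simp only [Multiset.countP_cons, mem_edgeSet, hxy, hxq, hyp, not_true_eq_false,
        not_false_eq_true, if_true, if_false] at this
      omega
    have hM' : ∀ e ∈ M, e ∈ cycleEdges l' := by
      intro e heM
      have h₁ : e ∈ s(x, y) ::ₘ s(p, q) ::ₘ cycleEdges l' := by
        rw [hrot]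
        exact Multiset.mem_cons_of_mem (Multiset.mem_cons_of_mem (hM e heM))
      rcases Multiset.mem_cons.1 h₁ with rfl | h₁
      · exact absurd (hMG heM) hxy
      rcases Multiset.mem_cons.1 h₁ with rfl | h₁
      · exact absurd (hMX _ heM p (Sym2.mem_mk_left p q)) hpX
      · exact h₁
    obtain ⟨l'', h₁, h₂⟩ := ih _ hlt l' (hperm.length_eq ▸ hl) (hperm.nodup_iff.2 hnd) hM'
      (fun z => by rw [hperm.length_eq, hperm.countP_eq]; exact hdeg z) rfl
    exact ⟨l'', h₁.trans hperm, h₂⟩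

lemma exists_walk_of_pathEdges (x y : V) (t : List V)
    (h : ∀ e ∈ pathEdges (x :: (t ++ [y])), e ∈ G.edgeSet) :
    ∃ p : G.Walk x y, p.support = x :: (t ++ [y]) ∧
      (p.edges : Multiset (Sym2 V)) = pathEdges (x :: (t ++ [y])) := by
  induction t generalizing x with
  | nil =>
    have hxy : G.Adj x y := h s(x, y) (by simp)
    exact ⟨.cons hxy .nil, by simp, by simp⟩
  | cons z t ih =>
    have hxz : G.Adj x z := h s(x, z) (by simp)
    obtain ⟨p, hs, he⟩ := ih z fun e he => h e (by
      rw [List.cons_append, pathEdges_cons_cons]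
      exact Multiset.mem_cons_of_mem he)
    refine ⟨.cons hxz p, by simp [hs], ?_⟩
    rw [Walk.edges_cons, ← Multiset.cons_coe, he]
    rfl

/-- A cyclic enumeration of all vertices using only edges of `G` is a Hamilton cycle. -/
lemma exists_isHamiltonianCycle_of_cycleEdges [Fintype V] [DecidableEq V] (l : List V)
    (hnd : l.Nodup) (hmem : ∀ v, v ∈ l) (hl : 3 ≤ l.length)
    (h : ∀ e ∈ cycleEdges l, e ∈ G.edgeSet) :
    ∃ (v : V) (p : G.Walk v v), p.IsHamiltonianCycle ∧
      (p.edges : Multiset (Sym2 V)) = cycleEdges l := by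
  cases l with
  | nil => simp at hl
  | cons x t =>
    obtain ⟨p, hs, he⟩ := G.exists_walk_of_pathEdges x x t h
    have hlen : p.length = t.length + 1 := by
      have := p.length_support
      rw [hs] at this
      simpa using this.symm
    have hnil : ¬ p.Nil := by
      rw [← Walk.length_eq_zero_iff]
      omega
    have hperm : (t ++ [x]).Perm (x :: t) := List.perm_append_comm (l₂ := [x])
    have hpath : p.tail.IsPath := by
      refine Walk.IsPath.mk' ?_
      rw [Walk.support_tail_of_not_nil _ hnil, hs, List.tail_cons]
      exact hperm.nodup_iff.2 hnd
    refine ⟨x, p, ⟨?_, hpath.isHamiltonian_of_mem fun w => ?_⟩, he⟩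
    · rw [Walk.isCycle_iff_isPath_tail_and_le_length]
      exact ⟨hpath, by rw [hlen]; simpa using hl⟩
    · rw [Walk.support_tail_of_not_nil _ hnil, hs, List.tail_cons]
      exact hperm.mem_iff.2 (hmem w)

end SimpleGraph

lemma exists_isHamiltonianCycle_sub_eq_sum_bowtieF {V : Type*} [Fintype V] [DecidableEq V]
    {r : ℕ} (N : ℕ) (hN : 1 ≤ N) (G : SimpleGraph V) [DecidableRel G.Adj] (χ : Sym2 V → Fin r)
    (hδ : Fintype.card V + 6 * N ≤ 2 * G.minDegree) (k : Fin r) (a b c d e : Fin N → V)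
    (hdistinct : Function.Injective
      fun p : Fin N × Fin 5 => ![a p.1, b p.1, c p.1, d p.1, e p.1] p.2)
    (hbow : ∀ i, IsBowtie G (a i) (b i) (c i) (d i) (e i)) :
    ∃ (v₁ : V) (H₁ : G.Walk v₁ v₁) (v₂ : V) (H₂ : G.Walk v₂ v₂),
      H₁.IsHamiltonianCycle ∧ H₂.IsHamiltonianCycle ∧
      ((H₁.edges.filter (fun ed => χ ed = k)).length : ℤ)
          - ((H₂.edges.filter (fun ed => χ ed = k)).length : ℤ) =
        ∑ i, bowtieF χ (a i) (b i) (c i) (d i) (e i) k := by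
  have hinj : ∀ (i j : Fin N) (s t : Fin 5), ![a i, b i, c i, d i, e i] s =
      ![a j, b j, c j, d j, e j] t → i = j ∧ s = t := fun i j s t h => by
    simpa using hdistinct (a₁ := (i, s)) (a₂ := (j, t)) h
  have ha : Function.Injective a := fun i j h => (hinj i j 0 0 h).1
  -- The matching edges of all bowties, followed by the vertices outside the bowties.
  let q : Fin N → List V := fun i => [b i, c i, d i, e i]
  have hq : ∀ i v, v ∈ q i ↔ v = b i ∨ v = c i ∨ v = d i ∨ v = e i := by simp [q]
  have haq : ∀ i j, a i ∉ q j := by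
    intro i j h
    rw [hq] at h
    rcases h with h | h | h | h
    · exact absurd (hinj i j 0 1 h).2 (by decide)
    · exact absurd (hinj i j 0 2 h).2 (by decide)
    · exact absurd (hinj i j 0 3 h).2 (by decide)
    · exact absurd (hinj i j 0 4 h).2 (by decide)
  let F : List V := (List.finRange N).flatMap q
  have hF : ∀ v, v ∈ F ↔ ∃ i, v ∈ q i := by simp [F]
  have hFlen : F.length = 4 * N := by simp [F, q, List.length_flatMap, mul_comm]
  have hFnd : F.Nodup := by
    refine List.nodup_flatMap.2 ⟨fun i _ => ?_, ?_⟩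
    · exact (hbow i).1.of_cons
    · refine (List.nodup_finRange N).imp fun {i j} hij v hi hj => hij ?_
      obtain ⟨s, hs⟩ : ∃ s, ![a i, b i, c i, d i, e i] s = v := by
        rcases (hq i v).1 hi with rfl | rfl | rfl | rfl
        exacts [⟨1, rfl⟩, ⟨2, rfl⟩, ⟨3, rfl⟩, ⟨4, rfl⟩]
      obtain ⟨t, ht⟩ : ∃ t, ![a j, b j, c j, d j, e j] t = v := by
        rcases (hq j v).1 hj with rfl | rfl | rfl | rfl
        exacts [⟨1, rfl⟩, ⟨2, rfl⟩, ⟨3, rfl⟩, ⟨4, rfl⟩]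
      exact (hinj i j s t (hs.trans ht.symm)).1
  let C : Finset V := Finset.univ.image a
  have hC : ∀ v, v ∈ C ↔ ∃ i, a i = v := by simp [C]
  have hCcard : C.card ≤ N := by simpa using Finset.card_image_le (s := Finset.univ) (f := a)
  let l : List V := F ++ (Finset.univ \ (F.toFinset ∪ C)).toList
  have hl : ∀ v, v ∈ l ↔ v ∉ C := by
    intro v
    have : v ∈ F → v ∉ C := by
      intro hv hvC
      obtain ⟨j, hj⟩ := (hF v).1 hv
      obtain ⟨i, rfl⟩ := (hC v).1 hvC
      exact haq i j hj
    simp only [l, List.mem_append, Finset.mem_toList, Finset.mem_sdiff, Finset.mem_univ,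
      true_and, Finset.mem_union, List.mem_toFinset]
    tauto
  have hlnd : l.Nodup := by
    refine List.nodup_append'.2 ⟨hFnd, Finset.nodup_toList _, fun v hv hv' => ?_⟩
    simp only [Finset.mem_toList, Finset.mem_sdiff, Finset.mem_union, List.mem_toFinset] at hv'
    exact hv'.2 (Or.inl hv)
  have hllen : 4 ≤ l.length := by
    simp only [l, List.length_append, hFlen]
    omega
  have hinfix : ∀ i, pathEdges (q i) ≤ cycleEdges l := by
    intro i
    refine (pathEdges_le_of_infix ?_).trans (pathEdges_le_cycleEdges l)
    obtain ⟨s, t, hst⟩ := List.append_of_mem (List.mem_finRange i)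
    refine ⟨s.flatMap q, t.flatMap q ++ (Finset.univ \ (F.toFinset ∪ C)).toList, ?_⟩
    simp only [l, F, hst, List.flatMap_append, List.flatMap_cons, List.append_assoc]
  let M : Set (Sym2 V) := {ed | ∃ i, ed = s(b i, c i) ∨ ed = s(d i, e i)}
  obtain ⟨l', hperm, hM, hE⟩ := G.exists_perm_cycleEdges_subset_edgeSet F.toFinset M
    (by
      rintro _ ⟨i, rfl | rfl⟩
      exacts [(hbow i).2.2.2.2.2.1, (hbow i).2.2.2.2.2.2])
    (by
      rintro _ ⟨i, rfl | rfl⟩ v hv <;> rw [List.mem_toFinset, hF] <;> refine ⟨i, (hq i v).2 ?_⟩ <;>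
        rw [Sym2.mem_iff] at hv <;> tauto)
    l (by omega) hlnd
    (by
      rintro _ ⟨i, rfl | rfl⟩ <;> exact Multiset.mem_of_le (hinfix i) (by simp [q]))
    (by
      intro x
      have h₁ : l.length ≤ Fintype.card V := hlnd.length_le_card
      have h₂ : F.toFinset.card ≤ 4 * N := hFlen ▸ F.toFinset_card_le
      have h₃ : G.degree x ≤ l.countP (fun v => G.Adj x v) + C.card := by
        rw [List.countP_eq_length_filter, ← List.toFinset_card_of_nodup (hlnd.filter _),
          ← G.card_neighborFinset_eq_degree]
        refine (Finset.card_le_card fun v hv => ?_).trans (Finset.card_union_le _ _)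
        have : G.Adj x v := by simpa using hv
        by_cases hvC : v ∈ C <;> simp [hvC, hl, this]
      have h₄ := G.minDegree_le_degree x
      omega)
  have hl' : ∀ v, v ∈ l' ↔ v ∉ C := fun v => (hperm.mem_iff).trans (hl v)
  -- Inserting all centres into the first, respectively second, matching edges.
  have key : ∀ u w : Fin N → V, (Function.Injective fun i => s(u i, w i)) →
      (∀ i, s(u i, w i) ∈ cycleEdges l') → (∀ i, G.Adj (a i) (u i)) → (∀ i, G.Adj (a i) (w i)) →
      ∃ (v : V) (H : G.Walk v v), H.IsHamiltonianCycle ∧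
        (H.edges : Multiset (Sym2 V)) + ∑ i, {s(u i, w i)} =
          cycleEdges l' + ∑ i, ({s(a i, u i)} + {s(a i, w i)}) := by
    intro u w huw hmem hu hw
    obtain ⟨L, hL, hLE⟩ := exists_insert_finset_cycleEdges u w a huw hmem
      (by rw [hperm.length_eq]; omega) Finset.univ
    have hLv : (L : Multiset V) = l' + C.val := by
      rw [hL, Finset.image_val_of_injOn ha.injOn, ← Multiset.sum_map_singleton
        (Multiset.map a Finset.univ.val), Multiset.map_map]
      rfl
    have hLnd : L.Nodup := by
      rw [← Multiset.coe_nodup, hLv, Multiset.nodup_add]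
      refine ⟨hperm.nodup_iff.2 hlnd, C.nodup, Multiset.disjoint_left.2 fun {v} hv hv' => ?_⟩
      exact (hl' v).1 hv hv'
    have hLmem : ∀ v, v ∈ L := by
      intro v
      rw [← Multiset.mem_coe, hLv, Multiset.mem_add, Multiset.mem_coe, hl']
      exact (em (v ∈ C)).symm
    have hLlen : 3 ≤ L.length := by
      rw [← Multiset.coe_card, hLv, Multiset.card_add, Multiset.coe_card, hperm.length_eq]
      omega
    obtain ⟨v, H, hH, hHE⟩ := G.exists_isHamiltonianCycle_of_cycleEdges L hLnd hLmem hLlen (by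
      intro ed hed
      have h₁ : ed ∈ cycleEdges l' + ∑ i, ({s(a i, u i)} + {s(a i, w i)}) :=
        hLE ▸ Multiset.mem_add.2 (Or.inl hed)
      rcases Multiset.mem_add.1 h₁ with h₁ | h₁
      · exact hE _ h₁
      · obtain ⟨i, -, hi⟩ := Multiset.mem_sum.1 h₁
        rcases Multiset.mem_add.1 hi with hi | hi <;> rw [Multiset.mem_singleton.1 hi]
        exacts [hu i, hw i])
    exact ⟨v, H, hH, by rw [hHE, hLE]⟩
  obtain ⟨v₁, H₁, hH₁, hE₁⟩ := key b c
    (fun i j h => by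
      rcases Sym2.eq_iff.1 h with ⟨h, -⟩ | ⟨h, -⟩
      exacts [(hinj i j 1 1 h).1, (hinj i j 1 2 h).1])
    (fun i => hM _ ⟨i, Or.inl rfl⟩) (fun i => (hbow i).2.1) (fun i => (hbow i).2.2.1)
  obtain ⟨v₂, H₂, hH₂, hE₂⟩ := key d e
    (fun i j h => by
      rcases Sym2.eq_iff.1 h with ⟨h, -⟩ | ⟨h, -⟩
      exacts [(hinj i j 3 3 h).1, (hinj i j 3 4 h).1])
    (fun i => hM _ ⟨i, Or.inr rfl⟩) (fun i => (hbow i).2.2.2.1) (fun i => (hbow i).2.2.2.2.1)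
  refine ⟨v₁, H₁, v₂, H₂, hH₁, hH₂, ?_⟩
  have hcount : ∀ L : List (Sym2 V), (L.filter (fun ed => χ ed = k)).length =
      Multiset.countPAddMonoidHom (fun ed => χ ed = k) (L : Multiset (Sym2 V)) := by
    intro L
    rw [Multiset.coe_countPAddMonoidHom, Multiset.coe_countP, List.countP_eq_length_filter]
  have hsingle : ∀ ed, Multiset.countPAddMonoidHom (fun ed => χ ed = k) {ed} =
      if χ ed = k then 1 else 0 := by
    intro ed
    rw [Multiset.coe_countPAddMonoidHom, ← Multiset.cons_zero, Multiset.countP_cons]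
    simp
  have h₁ := congrArg (fun s => (Multiset.countPAddMonoidHom (fun ed => χ ed = k) s : ℤ)) hE₁
  have h₂ := congrArg (fun s => (Multiset.countPAddMonoidHom (fun ed => χ ed = k) s : ℤ)) hE₂
  simp only [map_add, map_sum, hsingle, ← hcount] at h₁ h₂
  push_cast at h₁ h₂
  simp only [bowtieF, Finset.sum_add_distrib, Finset.sum_sub_distrib] at h₁ h₂ ⊢
  linarith

/-- Given `2m` pairwise vertex-disjoint bowties `B₁, …, B_{2m}` all with `f(Bᵢ, k) > 0`,
there are Hamilton cycles `H₁, H₂` whose numbers of `k`-colored edges differ by at least `2m`;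
in particular either `H₁` has at least `n/r + m` edges of color `k` or `H₂` has at most
`n/r − m` such edges, so some Hamilton cycle has color-bias at least `m`. -/
theorem statement6 {V : Type*} [Fintype V] [DecidableEq V] (r m : ℕ) (hr : 2 ≤ r) (hm : 1 ≤ m)
    (G : SimpleGraph V) [DecidableRel G.Adj] (χ : Sym2 V → Fin r)
    (hδ : (Fintype.card V : ℚ) / 2 + 6 * r ^ 2 * m ≤ (G.minDegree : ℚ))
    (k : Fin r) (a b c d e : Fin (2 * m) → V)
    (hdistinct : Function.Injective
      fun p : Fin (2 * m) × Fin 5 => ![a p.1, b p.1, c p.1, d p.1, e p.1] p.2)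
    (hbow : ∀ i : Fin (2 * m), IsBowtie G (a i) (b i) (c i) (d i) (e i))
    (hpos : ∀ i : Fin (2 * m), 0 < bowtieF χ (a i) (b i) (c i) (d i) (e i) k) :
    ∃ (v₁ : V) (H₁ : G.Walk v₁ v₁) (v₂ : V) (H₂ : G.Walk v₂ v₂),
      H₁.IsHamiltonianCycle ∧ H₂.IsHamiltonianCycle ∧
      (2 * m : ℤ) ≤ ((H₁.edges.filter (fun ed => χ ed = k)).length : ℤ)
          - ((H₂.edges.filter (fun ed => χ ed = k)).length : ℤ) ∧
      ((Fintype.card V : ℚ) / r + m ≤ ((H₁.edges.filter (fun ed => χ ed = k)).length : ℚ) ∨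
        ((H₂.edges.filter (fun ed => χ ed = k)).length : ℚ) ≤ (Fintype.card V : ℚ) / r - m) ∧
      ∃ (u : V) (H : G.Walk u u), H.IsHamiltonianCycle ∧
        ∃ i : Fin r,
          (m : ℚ) ≤
            |((H.edges.filter (fun ed => χ ed = i)).length : ℚ) - (Fintype.card V : ℚ) / r| := by
  have hr' : (4 : ℚ) ≤ (r : ℚ) ^ 2 := by
    have : (2 : ℚ) ≤ r := by exact_mod_cast hr
    nlinarith
  have hm' : (1 : ℚ) ≤ m := by exact_mod_cast hm
  have hδ' : Fintype.card V + 6 * (2 * m) ≤ 2 * G.minDegree := by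
    have : (Fintype.card V : ℚ) + 6 * (2 * m) ≤ 2 * G.minDegree := by nlinarith
    exact_mod_cast this
  obtain ⟨v₁, H₁, v₂, H₂, hH₁, hH₂, hsub⟩ := exists_isHamiltonianCycle_sub_eq_sum_bowtieF (2 * m)
    (by omega) G χ hδ' k a b c d e hdistinct hbow
  have hsum : (2 * m : ℤ) ≤ ∑ i, bowtieF χ (a i) (b i) (c i) (d i) (e i) k := by
    have := Finset.card_nsmul_le_sum Finset.univ
      (fun i => bowtieF χ (a i) (b i) (c i) (d i) (e i) k) 1 fun i _ => hpos i
    simpa using this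
  rw [← hsub] at hsum
  have hsumQ : (2 * m : ℚ) ≤ ((H₁.edges.filter (fun ed => χ ed = k)).length : ℚ)
      - ((H₂.edges.filter (fun ed => χ ed = k)).length : ℚ) := by exact_mod_cast hsum
  have hor : (Fintype.card V : ℚ) / r + m ≤ ((H₁.edges.filter (fun ed => χ ed = k)).length : ℚ) ∨
      ((H₂.edges.filter (fun ed => χ ed = k)).length : ℚ) ≤ (Fintype.card V : ℚ) / r - m := by
    by_contra! h
    linarith [h.1, h.2]
  refine ⟨v₁, H₁, v₂, H₂, hH₁, hH₂, hsum, hor, ?_⟩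
  rcases hor with h | h
  · exact ⟨v₁, H₁, hH₁, k, le_abs.2 (Or.inl (by linarith))⟩
  · exact ⟨v₂, H₂, hH₂, k, le_abs.2 (Or.inr (by linarith))⟩
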